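/- arXiv:2303.13246 — 2 statements merged into one kernel-verified Lean document; each statement's English description precedes it below -/
import Mathlib

section
/- Let g : S → ℝ be continuously differentiable, let ρᵈ : ℝ≥0 × S → ℝ be continuously differentiable, and let e : ℝ≥0 × S → ℝ be a continuously differentiable solution (C¹ in t, C² in x) of e_t = −K_p e + [ρᵈ Ṽ]_x − [e Ṽ]_x with Ṽ(t,·) = g * e(t,·). Then for all t ≥ 0, the time derivative of ‖e(t,·)‖₂² equals −2K_p ‖e(t,·)‖₂² − ∫_S e(t,x)² Ṽ_x(t,x) dx + 2∫_S ( e(t,x) ρᵈ_x(t,x) Ṽ(t,x) + e(t,x) ρᵈ(t,x) Ṽ_x(t,x) ) dx. -/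
open MeasureTheory Real Filter

/-- Circular convolution on `S = [-π, π]`. -/
noncomputable def circConv (f g : ℝ → ℝ) : ℝ → ℝ :=
  fun x => ∫ y in (-Real.pi)..Real.pi, f (x - y) * g y

open Set in
/-- **Leibniz rule**: differentiation under an interval integral for a jointly continuous integrand
with jointly continuous derivative in the parameter. -/
theorem hasDerivAt_intervalIntegral_of_continuous {F F' : ℝ → ℝ → ℝ} (a b : ℝ)
    (hF : Continuous (Function.uncurry F)) (hF' : Continuous (Function.uncurry F'))
    (h : ∀ t x, HasDerivAt (fun s => F s x) (F' t x) t) (t : ℝ) :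
    HasDerivAt (fun s => ∫ x in a..b, F s x) (∫ x in a..b, F' t x) t := by
  have hc : ∀ s, Continuous (F s) := fun s => hF.comp (Continuous.prodMk_right s)
  have hc' : ∀ s, Continuous (F' s) := fun s => hF'.comp (Continuous.prodMk_right s)
  obtain ⟨C, hC⟩ := ((isCompact_closedBall t 1).prod (isCompact_uIcc (a := a) (b := b))
    ).exists_bound_of_continuousOn hF'.continuousOn
  refine (intervalIntegral.hasDerivAt_integral_of_dominated_loc_of_deriv_le
    (bound := fun _ => C) (Metric.closedBall_mem_nhds t one_pos)
    (Eventually.of_forall fun s => (hc s).aestronglyMeasurable) ((hc t).intervalIntegrable a b)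
    (hc' t).aestronglyMeasurable ?_ intervalIntegrable_const ?_).2
  · exact Eventually.of_forall fun x hx s hs => hC (s, x) ⟨hs, uIoc_subset_uIcc hx⟩
  · exact Eventually.of_forall fun x _ s _ => h s x

theorem hasDerivAt_circConv {f g : ℝ → ℝ} (hf : ContDiff ℝ 1 f) (hg : Continuous g) (x : ℝ) :
    HasDerivAt (circConv f g) (circConv (deriv f) g x) x := by
  have hf' : Continuous (deriv f) := hf.continuous_deriv le_rfl
  have hfc : Continuous f := hf.continuous
  refine hasDerivAt_intervalIntegral_of_continuous (F := fun x y => f (x - y) * g y)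
    (F' := fun x y => deriv f (x - y) * g y) _ _ ?_ ?_ (fun t y => ?_) x
  · simp only [Function.uncurry_def]; fun_prop
  · simp only [Function.uncurry_def]; fun_prop
  · exact ((hf.differentiable one_ne_zero (t - y)).hasDerivAt.comp_sub_const t y).mul_const (g y)

theorem continuous_circConv {f g : ℝ → ℝ} (hf : Continuous f) (hg : Continuous g) :
    Continuous (circConv f g) := by
  refine intervalIntegral.continuous_parametric_intervalIntegral_of_continuous'
    (f := fun x y => f (x - y) * g y) ?_ _ _
  simp only [Function.uncurry_def]
  fun_prop

theorem periodic_circConv {f : ℝ → ℝ} {T : ℝ} (hf : Function.Periodic f T) (g : ℝ → ℝ) :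
    Function.Periodic (circConv f g) T := fun x => by
  simp only [circConv, add_sub_right_comm, hf _]

theorem Function.Periodic.intervalIntegral_eq_zero_of_hasDerivAt {f f' : ℝ → ℝ}
    (hper : Function.Periodic f (2 * Real.pi)) (hf : ∀ x, HasDerivAt f (f' x) x)
    (hf' : Continuous f') : ∫ x in (-Real.pi)..Real.pi, f' x = 0 := by
  rw [intervalIntegral.integral_eq_sub_of_hasDerivAt (fun x _ => hf x)
    (hf'.intervalIntegrable _ _), sub_eq_zero, ← hper (-Real.pi)]
  ring_nf

/-- **Equation (16) of the paper.** Differentiating `‖e(t,·)‖₂²` along the error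
dynamics with limited sensing, with `Ṽ(t,·) = g * e(t,·)`. -/
theorem norm_sq_derivative_limited_sensing
    (g : ℝ → ℝ) (hg : ContDiff ℝ 1 g) (hgper : Function.Periodic g (2 * Real.pi))
    (ρd : ℝ → ℝ → ℝ)
    (hρd : ContDiff ℝ 1 (fun p : ℝ × ℝ => ρd p.1 p.2))
    (hρdper : ∀ t, Function.Periodic (ρd t) (2 * Real.pi))
    (Kp : ℝ)
    (e : ℝ → ℝ → ℝ)
    (he1 : ContDiff ℝ 1 (fun p : ℝ × ℝ => e p.1 p.2))
    (he2 : ∀ t, ContDiff ℝ 2 (e t))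
    (heper : ∀ t, Function.Periodic (e t) (2 * Real.pi))
    (hdyn : ∀ t, 0 ≤ t → ∀ x : ℝ,
      HasDerivAt (fun τ => e τ x)
        (-Kp * e t x
          + deriv (fun y => ρd t y * circConv g (e t) y) x
          - deriv (fun y => e t y * circConv g (e t) y) x) t) :
    ∀ t, 0 ≤ t →
      HasDerivAt (fun τ => ∫ x in (-Real.pi)..Real.pi, e τ x ^ 2)
        (-2 * Kp * (∫ x in (-Real.pi)..Real.pi, e t x ^ 2)
          - (∫ x in (-Real.pi)..Real.pi, e t x ^ 2 * deriv (circConv g (e t)) x)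
          + 2 * ∫ x in (-Real.pi)..Real.pi,
              (e t x * deriv (ρd t) x * circConv g (e t) x
                + e t x * ρd t x * deriv (circConv g (e t)) x)) t := by
  intro t ht
  set E := fun p : ℝ × ℝ => e p.1 p.2
  set V := circConv g (e t) with hV
  have hec : Continuous (e t) := (he2 t).continuous
  have he' : Continuous (deriv (e t)) := (he2 t).continuous_deriv one_le_two
  have hρ : ContDiff ℝ 1 (ρd t) := hρd.comp (contDiff_const.prodMk contDiff_id)
  have hρc : Continuous (ρd t) := hρ.continuous
  have hρ' : Continuous (deriv (ρd t)) := hρ.continuous_deriv le_rfl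
  have hdV : ∀ x, HasDerivAt V (deriv V x) x := fun x =>
    (hasDerivAt_circConv hg hec x).differentiableAt.hasDerivAt
  have hVc : Continuous V := continuous_circConv hg.continuous hec
  have hV' : Continuous (deriv V) := by
    rw [show deriv V = circConv (deriv g) (e t) from
      funext fun x => (hasDerivAt_circConv hg hec x).deriv]
    exact continuous_circConv (hg.continuous_deriv le_rfl) hec
  have hde : ∀ x, HasDerivAt (e t) (deriv (e t) x) x := fun x =>
    ((he2 t).differentiable two_ne_zero x).hasDerivAt
  have hdρ : ∀ x, HasDerivAt (ρd t) (deriv (ρd t) x) x := fun x =>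
    (hρ.differentiable one_ne_zero x).hasDerivAt
  have hEc : Continuous E := he1.continuous
  have hE' : Continuous fun p : ℝ × ℝ => fderiv ℝ E p (1, 0) :=
    (he1.continuous_fderiv one_ne_zero).clm_apply continuous_const
  have hdt : ∀ s x, HasDerivAt (fun τ => e τ x) (fderiv ℝ E (s, x) (1, 0)) s := fun s x =>
    (he1.differentiable one_ne_zero (s, x)).hasFDerivAt.comp_hasDerivAt (f := fun τ => (τ, x)) s
      ((hasDerivAt_id s).prodMk (hasDerivAt_const s x))
  have hleib := hasDerivAt_intervalIntegral_of_continuous (F := fun s x => e s x ^ 2)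
    (F' := fun s x => 2 * e s x * fderiv ℝ E (s, x) (1, 0)) (-Real.pi) Real.pi
    (hEc.fun_pow 2) ((continuous_const.mul hEc).mul hE')
    (fun s x => by simpa using (hdt s x).fun_pow 2) t
  have hzero : ∫ x in (-Real.pi)..Real.pi,
      (2 * e t x * deriv (e t) x * V x + e t x ^ 2 * deriv V x) = 0 := by
    refine Function.Periodic.intervalIntegral_eq_zero_of_hasDerivAt
      (f := fun x => e t x ^ 2 * V x) (fun x => ?_) (fun x => ?_) (by fun_prop)
    · simp only [heper t x, periodic_circConv hgper (e t) x, hV]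
    · simpa using ((hde x).fun_pow 2).fun_mul (hdV x)
  have hpt : ∀ x, 2 * e t x * fderiv ℝ E (t, x) (1, 0) =
      -2 * Kp * e t x ^ 2 - e t x ^ 2 * deriv V x
        + 2 * (e t x * deriv (ρd t) x * V x + e t x * ρd t x * deriv V x)
        - (2 * e t x * deriv (e t) x * V x + e t x ^ 2 * deriv V x) := fun x => by
    rw [(hdt t x).unique (hdyn t ht x), ((hdρ x).fun_mul (hdV x)).deriv, ((hde x).fun_mul (hdV x)).deriv]
    ring
  convert hleib using 1
  simp only [hpt]
  have hii : ∀ {f : ℝ → ℝ}, Continuous f →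
      IntervalIntegrable f volume (-Real.pi) Real.pi := fun hf => hf.intervalIntegrable _ _
  conv_rhs => rw [intervalIntegral.integral_sub (hii (by fun_prop)) (hii (by fun_prop)), hzero, sub_zero,
    intervalIntegral.integral_add (hii (by fun_prop)) (hii (by fun_prop)),
    intervalIntegral.integral_sub (hii (by fun_prop)) (hii (by fun_prop)),
    intervalIntegral.integral_const_mul, intervalIntegral.integral_const_mul]
end

section
/- Let M, L, D₁, D₂ > 0, let ρᵈ : ℝ≥0 × S → ℝ be continuously differentiable with ‖ρᵈ(t,·)‖₂ ≤ M and ‖ρᵈ_x(t,·)‖₂ ≤ L for all t ≥ 0, and let d : ℝ≥0 × S → ℝ be continuously differentiable in x with ‖d(t,·)‖_∞ ≤ D₁ and ‖d_x(t,·)‖_∞ ≤ D₂ for all t ≥ 0. Let e : ℝ≥0 × S → ℝ be a continuously differentiable solution of e_t = −K_p e + [(ρᵈ − e) d]_x. Then for all t ≥ 0, the time derivative of ‖e(t,·)‖₂² is at most ( −2K_p + D₂ ) ‖e(t,·)‖₂² + ( 2LD₁ + 2MD₂ ) ‖e(t,·)‖₂. -/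
open MeasureTheory Real Filter

/-- The `L²`-norm on the circle `S = [-π, π]` (endpoints identified). -/
noncomputable def L2norm (h : ℝ → ℝ) : ℝ :=
  Real.sqrt (∫ x in (-Real.pi)..Real.pi, h x ^ 2)

/-- The `L^∞`-norm (essential supremum) on the circle `S = [-π, π]`. -/
noncomputable def LinfNorm (h : ℝ → ℝ) : ENNReal :=
  MeasureTheory.eLpNorm h ⊤ (MeasureTheory.volume.restrict (Set.Ioc (-Real.pi) Real.pi))

/-- Differentiation under the integral sign for a jointly `C¹` integrand on a compact interval. -/
theorem hasDerivAt_intervalIntegral_of_contDiff {F : ℝ → ℝ → ℝ}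
    (hF : ContDiff ℝ 1 (fun p : ℝ × ℝ => F p.1 p.2)) (a b t : ℝ) :
    HasDerivAt (fun τ => ∫ x in a..b, F τ x) (∫ x in a..b, deriv (fun τ => F τ x) t) t := by
  have hdiff : ∀ τ x, HasDerivAt (fun τ => F τ x)
      (fderiv ℝ (fun p : ℝ × ℝ => F p.1 p.2) (τ, x) (1, 0)) τ := fun τ x =>
    HasFDerivAt.comp_hasDerivAt (f := fun τ => (τ, x)) τ
      (hF.differentiable one_ne_zero (τ, x)).hasFDerivAt
      ((hasDerivAt_id τ).prodMk (hasDerivAt_const τ x))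
  have hcont : Continuous fun p : ℝ × ℝ =>
      fderiv ℝ (fun p : ℝ × ℝ => F p.1 p.2) p (1, 0) :=
    (hF.continuous_fderiv one_ne_zero).clm_apply continuous_const
  have hslice : ∀ τ, Continuous (F τ) := fun τ =>
    hF.continuous.comp (continuous_const.prodMk continuous_id)
  obtain ⟨C, hC⟩ := ((isCompact_closedBall t 1).prod
    (isCompact_uIcc (a := a) (b := b))).exists_bound_of_continuousOn hcont.continuousOn
  simp_rw [fun x => (hdiff t x).deriv]
  refine (intervalIntegral.hasDerivAt_integral_of_dominated_loc_of_deriv_le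
    (F' := fun τ x => fderiv ℝ (fun p : ℝ × ℝ => F p.1 p.2) (τ, x) (1, 0)) (bound := fun _ => C)
    (Metric.closedBall_mem_nhds t one_pos)
    (Eventually.of_forall fun τ => (hslice τ).aestronglyMeasurable)
    ((hslice t).intervalIntegrable a b)
    (hcont.comp (continuous_const.prodMk continuous_id)).aestronglyMeasurable
    (ae_of_all _ fun x hx τ hτ => hC (τ, x) ⟨hτ, Set.uIoc_subset_uIcc hx⟩)
    intervalIntegrable_const
    (ae_of_all _ fun x _ τ _ => hdiff τ x)).2

theorem ae_abs_le_of_LinfNorm_le {h : ℝ → ℝ} {D : ℝ} (hD : 0 ≤ D)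
    (hh : LinfNorm h ≤ ENNReal.ofReal D) :
    ∀ᵐ x ∂(volume.restrict (Set.Icc (-π) π)), |h x| ≤ D := by
  rw [← restrict_Ioc_eq_restrict_Icc]
  filter_upwards [ae_le_eLpNormEssSup (f := h) (μ := volume.restrict (Set.Ioc (-π) π))] with x hx
  rw [LinfNorm, eLpNorm_exponent_top] at hh
  have := hx.trans hh
  rwa [Real.enorm_eq_ofReal_abs, ENNReal.ofReal_le_ofReal_iff hD] at this

theorem neg_pi_le_pi : -π ≤ π := by linarith [pi_pos]

theorem L2norm_sq (h : ℝ → ℝ) : L2norm h ^ 2 = ∫ x in (-π)..π, h x ^ 2 :=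
  Real.sq_sqrt (intervalIntegral.integral_nonneg neg_pi_le_pi fun _ _ => sq_nonneg _)

theorem L2norm_nonneg (h : ℝ → ℝ) : 0 ≤ L2norm h := Real.sqrt_nonneg _

/-- The Cauchy–Schwarz inequality on the circle. -/
theorem integral_mul_le_L2norm_mul_L2norm {f g : ℝ → ℝ} (hf : Continuous f) (hg : Continuous g) :
    ∫ x in (-π)..π, f x * g x ≤ L2norm f * L2norm g := by
  have hquad : ∀ s : ℝ, 0 ≤ L2norm f ^ 2 * (s * s)
      + (2 * ∫ x in (-π)..π, f x * g x) * s + L2norm g ^ 2 := by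
    intro s
    have hnonneg : 0 ≤ ∫ x in (-π)..π, (s * f x + g x) ^ 2 :=
      intervalIntegral.integral_nonneg neg_pi_le_pi fun _ _ => sq_nonneg _
    have hexp : ∀ x, (s * f x + g x) ^ 2 = s * s * f x ^ 2 + 2 * s * (f x * g x) + g x ^ 2 :=
      fun x => by ring
    simp_rw [hexp] at hnonneg
    rw [intervalIntegral.integral_add (Continuous.intervalIntegrable (by fun_prop) _ _)
        (Continuous.intervalIntegrable (by fun_prop) _ _),
      intervalIntegral.integral_add (Continuous.intervalIntegrable (by fun_prop) _ _)
        (Continuous.intervalIntegrable (by fun_prop) _ _),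
      intervalIntegral.integral_const_mul, intervalIntegral.integral_const_mul,
      ← L2norm_sq, ← L2norm_sq] at hnonneg
    linarith
  have hdisc := discrim_le_zero hquad
  rw [discrim] at hdisc
  refine abs_le_of_sq_le_sq' ?_ (mul_nonneg (L2norm_nonneg f) (L2norm_nonneg g)) |>.2
  nlinarith

/-- Hölder's inequality `‖h g‖₂ ≤ ‖h‖_∞ ‖g‖₂` on the circle. -/
theorem L2norm_mul_le {g h : ℝ → ℝ} (hg : Continuous g) (hh : Continuous h) {D : ℝ} (hD : 0 ≤ D)
    (hhD : LinfNorm h ≤ ENNReal.ofReal D) :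
    L2norm (fun x => g x * h x) ≤ L2norm g * D := by
  refine abs_le_of_sq_le_sq' ?_ (mul_nonneg (L2norm_nonneg g) hD) |>.2
  rw [mul_pow, L2norm_sq, L2norm_sq, ← intervalIntegral.integral_mul_const]
  refine intervalIntegral.integral_mono_ae_restrict neg_pi_le_pi
    (Continuous.intervalIntegrable (by fun_prop) _ _)
    (Continuous.intervalIntegrable (by fun_prop) _ _) ?_
  filter_upwards [ae_abs_le_of_LinfNorm_le hD hhD] with x hx
  rw [mul_pow]
  exact mul_le_mul_of_nonneg_left (sq_le_sq' (abs_le.1 hx).1 (abs_le.1 hx).2) (sq_nonneg _)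

theorem integral_mul_mul_le {f g h : ℝ → ℝ} (hf : Continuous f) (hg : Continuous g)
    (hh : Continuous h) {C D : ℝ} (hgC : L2norm g ≤ C) (hD : 0 ≤ D)
    (hhD : LinfNorm h ≤ ENNReal.ofReal D) :
    ∫ x in (-π)..π, f x * (g x * h x) ≤ L2norm f * (C * D) :=
  (integral_mul_le_L2norm_mul_L2norm hf (hg.mul hh)).trans <|
    mul_le_mul_of_nonneg_left
      ((L2norm_mul_le hg hh hD hhD).trans (mul_le_mul_of_nonneg_right hgC hD)) (L2norm_nonneg f)

/-- Energy estimate for the transport operator `u ↦ -K u + [(r - u) v]_x` on the circle. -/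
theorem integral_two_mul_transport_le {M L D₁ D₂ K : ℝ} (hD₁ : 0 ≤ D₁) (hD₂ : 0 ≤ D₂)
    {r u v : ℝ → ℝ} (hr : ContDiff ℝ 1 r) (hu : ContDiff ℝ 1 u) (hv : ContDiff ℝ 1 v)
    (huper : Function.Periodic u (2 * π)) (hvper : Function.Periodic v (2 * π))
    (hrM : L2norm r ≤ M) (hrL : L2norm (fun x => deriv r x) ≤ L)
    (hvD₁ : LinfNorm v ≤ ENNReal.ofReal D₁)
    (hvD₂ : LinfNorm (fun x => deriv v x) ≤ ENNReal.ofReal D₂) :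
    ∫ x in (-π)..π, 2 * u x * (-K * u x + deriv (fun y => (r y - u y) * v y) x)
      ≤ (-(2 * K) + D₂) * L2norm u ^ 2 + (2 * L * D₁ + 2 * M * D₂) * L2norm u := by
  have hasDeriv : ∀ {w : ℝ → ℝ}, ContDiff ℝ 1 w → ∀ x, HasDerivAt w (deriv w x) x :=
    fun hw x => (hw.differentiable one_ne_zero x).hasDerivAt
  have cr := hr.continuous
  have cu := hu.continuous
  have cv := hv.continuous
  have cr' := hr.continuous_deriv_one
  have cu' := hu.continuous_deriv_one
  have cv' := hv.continuous_deriv_one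
  have hflux : ∀ x, deriv (fun y => (r y - u y) * v y) x
      = (deriv r x - deriv u x) * v x + (r x - u x) * deriv v x := fun x =>
    (((hasDeriv hr x).sub (hasDeriv hu x)).mul (hasDeriv hv x)).deriv
  have hzero : ∫ x in (-π)..π, (2 * u x * deriv u x * v x + u x ^ 2 * deriv v x) = 0 := by
    have hder : ∀ x ∈ Set.uIcc (-π) π, HasDerivAt (fun y => u y ^ 2 * v y)
        (2 * u x * deriv u x * v x + u x ^ 2 * deriv v x) x := fun x _ => by
      simpa using ((hasDeriv hu x).fun_pow 2).fun_mul (hasDeriv hv x)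
    rw [intervalIntegral.integral_eq_sub_of_hasDerivAt hder
      (Continuous.intervalIntegrable (by fun_prop) _ _)]
    have hπ : π = -π + 2 * π := by ring
    have hu' : u π = u (-π) := by rw [← huper (-π), ← hπ]
    have hv' : v π = v (-π) := by rw [← hvper (-π), ← hπ]
    simp only [hu', hv', sub_self]
  have hdiv : ∫ x in (-π)..π, -(u x ^ 2 * deriv v x) ≤ D₂ * L2norm u ^ 2 := by
    rw [L2norm_sq, ← intervalIntegral.integral_const_mul]
    refine intervalIntegral.integral_mono_ae_restrict neg_pi_le_pi
      (Continuous.intervalIntegrable (by fun_prop) _ _)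
      (Continuous.intervalIntegrable (by fun_prop) _ _) ?_
    filter_upwards [ae_abs_le_of_LinfNorm_le hD₂ hvD₂] with x hx
    nlinarith [(abs_le.1 hx).1, sq_nonneg (u x)]
  have hsplit : ∫ x in (-π)..π, 2 * u x * (-K * u x + deriv (fun y => (r y - u y) * v y) x)
      = -(2 * K) * (∫ x in (-π)..π, u x ^ 2)
        + 2 * (∫ x in (-π)..π, u x * (deriv r x * v x))
        + 2 * (∫ x in (-π)..π, u x * (r x * deriv v x))
        + (∫ x in (-π)..π, -(u x ^ 2 * deriv v x))
        - ∫ x in (-π)..π, (2 * u x * deriv u x * v x + u x ^ 2 * deriv v x) := by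
    simp_rw [hflux, ← intervalIntegral.integral_const_mul]
    rw [← intervalIntegral.integral_add, ← intervalIntegral.integral_add,
      ← intervalIntegral.integral_add, ← intervalIntegral.integral_sub]
    · exact intervalIntegral.integral_congr fun x _ => by ring
    all_goals exact Continuous.intervalIntegrable (by fun_prop) _ _
  have h₁ := integral_mul_mul_le cu cr' cv hrL hD₁ hvD₁
  have h₂ := integral_mul_mul_le cu cr cv' hrM hD₂ hvD₂
  rw [hsplit, hzero, ← L2norm_sq]
  linarith

/-- **Equation (27) of the paper.** Differential inequality for `‖e(t,·)‖₂²` under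
a spatio-temporal velocity-field disturbance `d`. -/
theorem norm_sq_diff_ineq_velocity_disturbance
    (M L D₁ D₂ : ℝ) (hM : 0 < M) (hL : 0 < L) (hD₁ : 0 < D₁) (hD₂ : 0 < D₂)
    (ρd : ℝ → ℝ → ℝ)
    (hρd : ContDiff ℝ 1 (fun p : ℝ × ℝ => ρd p.1 p.2))
    (hρdper : ∀ t, Function.Periodic (ρd t) (2 * Real.pi))
    (hρdM : ∀ t, 0 ≤ t → L2norm (ρd t) ≤ M)
    (hρdL : ∀ t, 0 ≤ t → L2norm (fun x => deriv (ρd t) x) ≤ L)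
    (d : ℝ → ℝ → ℝ)
    (hd : ∀ t, ContDiff ℝ 1 (d t))
    (hdper : ∀ t, Function.Periodic (d t) (2 * Real.pi))
    (hdD₁ : ∀ t, 0 ≤ t → LinfNorm (d t) ≤ ENNReal.ofReal D₁)
    (hdD₂ : ∀ t, 0 ≤ t → LinfNorm (fun x => deriv (d t) x) ≤ ENNReal.ofReal D₂)
    (Kp : ℝ)
    (e : ℝ → ℝ → ℝ)
    (he1 : ContDiff ℝ 1 (fun p : ℝ × ℝ => e p.1 p.2))
    (heper : ∀ t, Function.Periodic (e t) (2 * Real.pi))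
    (hdyn : ∀ t, 0 ≤ t → ∀ x : ℝ,
      HasDerivAt (fun τ => e τ x)
        (-Kp * e t x
          + deriv (fun y => (ρd t y - e t y) * d t y) x) t) :
    ∀ t, 0 ≤ t → ∃ y : ℝ,
      HasDerivAt (fun τ => ∫ x in (-Real.pi)..Real.pi, e τ x ^ 2) y t ∧
        y ≤ (-(2 * Kp) + D₂) * L2norm (e t) ^ 2
              + (2 * L * D₁ + 2 * M * D₂) * L2norm (e t) := by
  intro t ht
  refine ⟨_, hasDerivAt_intervalIntegral_of_contDiff (he1.pow 2) _ _ t, ?_⟩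
  have hder : ∀ x, deriv (fun τ => e τ x ^ 2) t
      = 2 * e t x * (-Kp * e t x + deriv (fun y => (ρd t y - e t y) * d t y) x) := fun x => by
    simpa using ((hdyn t ht x).fun_pow 2).deriv
  have hslice : ContDiff ℝ 1 (fun x : ℝ => (t, x)) := contDiff_const.prodMk contDiff_id
  simp_rw [hder]
  exact integral_two_mul_transport_le hD₁.le hD₂.le (hρd.comp hslice) (he1.comp hslice) (hd t)
    (heper t) (hdper t) (hρdM t ht) (hρdL t ht) (hdD₁ t ht) (hdD₂ t ht)
end
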